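/- Let d be a positive integer and let Ω ⊆ ℝ^d be a domain (a nonempty open connected set). Then for a typical function f ∈ C(Ω), the set {x ∈ Ω : lip f(x) = Lip f(x)} has Hausdorff dimension d−1 and lower packing dimension d−1. -/

import Mathlib

open Filter Set Topology MeasureTheory
open scoped ENNReal NNReal

noncomputable section

/-- A gauge: nondecreasing on `[0,∞)`, right-continuous, `φ 0 = 0`, positive on `(0,∞)`. -/
def IsGauge (φ : ℝ → ℝ) : Prop :=
  (∀ ⦃a b : ℝ⦄, 0 ≤ a → a ≤ b → φ a ≤ φ b) ∧
  (∀ a : ℝ, 0 ≤ a → ContinuousWithinAt φ (Set.Ici a) a) ∧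
  φ 0 = 0 ∧ (∀ r : ℝ, 0 < r → 0 < φ r)

/-- `N_δ(E)`: the least number of sets of diameter at most `δ` needed to cover `E`. -/
def coverNum {X : Type*} [PseudoMetricSpace X] (δ : ℝ) (E : Set X) : ℝ≥0∞ :=
  ⨅ (n : ℕ) (_ : ∃ F : Fin n → Set X,
    (∀ i, EMetric.diam (F i) ≤ ENNReal.ofReal δ) ∧ E ⊆ ⋃ i, F i), (n : ℝ≥0∞)

/-- `ν_0^ζ(E) = liminf_{δ→0+} N_δ(E)·ζ(δ)`. -/
def nu0 {X : Type*} [PseudoMetricSpace X] (ζ : ℝ → ℝ) (E : Set X) : ℝ≥0∞ :=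
  Filter.liminf (fun δ : ℝ => coverNum δ E * ENNReal.ofReal (ζ δ)) (𝓝[>] (0:ℝ))

/-- The lower box-counting measure `ν^ζ`. -/
def lowerBoxMeasure {X : Type*} [PseudoMetricSpace X] (ζ : ℝ → ℝ) (E : Set X) : ℝ≥0∞ :=
  ⨅ (G : ℕ → Set X) (_ : E ⊆ ⋃ n, G n), ∑' n, nu0 ζ (G n)

/-- The lower box dimension `lbdim E = liminf_{r→0+} log N_r(E)/|log r|`. -/
def lbdim {X : Type*} [PseudoMetricSpace X] (E : Set X) : EReal :=
  Filter.liminf (fun r : ℝ => ENNReal.log (coverNum r E) * ((|Real.log r|⁻¹ : ℝ) : EReal))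
    (𝓝[>] (0:ℝ))

/-- The lower packing dimension. -/
def lpdim {X : Type*} [PseudoMetricSpace X] (E : Set X) : EReal :=
  ⨅ (G : ℕ → Set X) (_ : E ⊆ ⋃ n, G n), ⨆ n, lbdim (G n)

/-- The generalized lower scaled oscillation `lip_φ f`. -/
def lipGauge {X : Type*} [PseudoMetricSpace X] (φ : ℝ → ℝ) (f : X → ℝ) (x : X) : ℝ≥0∞ :=
  Filter.liminf
    (fun r : ℝ => EMetric.diam (f '' Metric.closedBall x r) / ENNReal.ofReal (φ r))
    (𝓝[>] (0:ℝ))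

/-- The upper scaled oscillation `Lip f`. -/
def LipGauge {X : Type*} [PseudoMetricSpace X] (φ : ℝ → ℝ) (f : X → ℝ) (x : X) : ℝ≥0∞ :=
  Filter.limsup
    (fun r : ℝ => EMetric.diam (f '' Metric.closedBall x r) / ENNReal.ofReal (φ r))
    (𝓝[>] (0:ℝ))

/-- The Hausdorff measure with gauge `ξ`. -/
def hausdorffGauge {X : Type*} [PseudoMetricSpace X] (ξ : ℝ → ℝ) (E : Set X) : ℝ≥0∞ :=
  ⨆ (δ : ℝ) (_ : 0 < δ), ⨅ (G : ℕ → Set X) (_ : E ⊆ ⋃ n, G n)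
    (_ : ∀ n, EMetric.diam (G n) ≤ ENNReal.ofReal δ),
    ∑' n, ENNReal.ofReal (ξ (EMetric.diam (G n)).toReal)

/-- A box in `ℝ^k`. -/
def IsBox {k : ℕ} (S : Set (EuclideanSpace ℝ (Fin k))) : Prop :=
  ∃ a b : Fin k → ℝ, S = {x | ∀ i, x i ∈ Set.Icc (a i) (b i)}

/-- A microscopic subset of `ℝ^k`. -/
def Microscopic {k : ℕ} (X : Set (EuclideanSpace ℝ (Fin k))) : Prop :=
  ∀ ε : ℝ, 0 < ε → ∃ B : ℕ → Set (EuclideanSpace ℝ (Fin k)),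
    (∀ n, IsBox (B n)) ∧ X ⊆ ⋃ n, B n ∧
    ∀ n, MeasureTheory.volume (B n) ≤ ENNReal.ofReal (ε ^ (n + 1))

/-- A microscopic subset of `ℝ`. -/
def MicroscopicR (E : Set ℝ) : Prop :=
  ∀ ε : ℝ, 0 < ε → ∃ I : ℕ → ℝ × ℝ,
    E ⊆ ⋃ n, Set.Icc (I n).1 (I n).2 ∧
    ∀ n, MeasureTheory.volume (Set.Icc (I n).1 (I n).2) ≤ ENNReal.ofReal (ε ^ (n + 1))

end


/-! ### Covering numbers and dimensions -/

section Dimension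

variable {X : Type*}

theorem coverNum_le_card [PseudoMetricSpace X] {ι : Type*} [Fintype ι] {δ : ℝ} {E : Set X}
    (F : ι → Set X) (hF : ∀ i, Metric.ediam (F i) ≤ ENNReal.ofReal δ) (hE : E ⊆ ⋃ i, F i) :
    coverNum δ E ≤ (Fintype.card ι : ℝ≥0∞) := by
  refine iInf₂_le (Fintype.card ι) ⟨fun i => F ((Fintype.equivFin ι).symm i), fun i => hF _, ?_⟩
  intro x hx
  obtain ⟨i, hi⟩ := mem_iUnion.1 (hE hx)
  exact mem_iUnion.2 ⟨Fintype.equivFin ι i, by simpa using hi⟩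

theorem coverNum_mono [PseudoMetricSpace X] {δ : ℝ} {E E' : Set X} (h : E ⊆ E') :
    coverNum δ E ≤ coverNum δ E' :=
  le_iInf₂ fun n ⟨F, hF, hE⟩ => iInf₂_le n ⟨F, hF, h.trans hE⟩

theorem one_le_coverNum [PseudoMetricSpace X] {δ : ℝ} {E : Set X} (hE : E.Nonempty) :
    1 ≤ coverNum δ E := by
  refine le_iInf₂ fun n ⟨F, hF, hEF⟩ => ?_
  obtain ⟨x, hx⟩ := hE
  obtain ⟨i, -⟩ := mem_iUnion.1 (hEF hx)
  exact_mod_cast i.pos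

theorem log_mul_inv_le_iff {x : ℝ≥0∞} {L t : ℝ} (hL : 0 < L) :
    ENNReal.log x * ((L⁻¹ : ℝ) : EReal) ≤ (t : EReal) ↔ x ≤ ENNReal.ofReal (Real.exp (t * L)) := by
  have h1 : ENNReal.log x * ((L⁻¹ : ℝ) : EReal) = ENNReal.log x / (L : EReal) := by
    rw [EReal.coe_inv]; rfl
  rw [h1, EReal.div_le_iff_le_mul (by exact_mod_cast hL) (EReal.coe_ne_top _), mul_comm t L,
    ← EReal.exp_coe, ← EReal.coe_mul, ← EReal.log_exp ((L * t : ℝ) : EReal),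
    ENNReal.log_le_log_iff, EReal.log_exp]

theorem lbdim_nonneg [PseudoMetricSpace X] {E : Set X} (hE : E.Nonempty) : 0 ≤ lbdim E := by
  refine le_liminf_of_le (by isBoundedDefault) (Eventually.of_forall fun r => ?_)
  have h : 0 ≤ ENNReal.log (coverNum r E) := by
    rw [← ENNReal.log_one]
    exact ENNReal.log_monotone (one_le_coverNum hE)
  exact mul_nonneg h (by exact_mod_cast inv_nonneg.2 (abs_nonneg _))

theorem eventually_zero_lt_and_lt {b : ℝ} (hb : 0 < b) : ∀ᶠ r in 𝓝[>] (0 : ℝ), 0 < r ∧ r < b :=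
  Ioo_mem_nhdsGT hb

theorem exp_mul_abs_log {r : ℝ} (h0 : 0 < r) (h1 : r < 1) (t : ℝ) :
    Real.exp (t * |Real.log r|) = r ^ (-t) := by
  rw [abs_of_neg (Real.log_neg h0 h1), Real.rpow_def_of_pos h0]
  ring_nf

theorem lbdim_le_of_frequently [PseudoMetricSpace X] {E : Set X} {t : ℝ}
    (h : ∃ᶠ r in 𝓝[>] (0 : ℝ), coverNum r E ≤ ENNReal.ofReal (r ^ (-t))) :
    lbdim E ≤ (t : EReal) := by
  refine liminf_le_of_frequently_le ?_
  refine (h.and_eventually (eventually_zero_lt_and_lt one_pos)).mono fun r ⟨hr, h0, h1⟩ => ?_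
  rw [log_mul_inv_le_iff (abs_pos.2 (Real.log_neg h0 h1).ne), exp_mul_abs_log h0 h1]
  exact hr

theorem dimH_le_of_frequently [MetricSpace X] {E : Set X} {t : ℝ≥0}
    (h : ∃ᶠ r in 𝓝[>] (0 : ℝ), coverNum r E ≤ ENNReal.ofReal (r ^ (-(t : ℝ)))) :
    dimH E ≤ t := by
  borelize X
  obtain ⟨r, hr, hrE⟩ := exists_seq_forall_of_frequently
    (h.and_eventually (eventually_zero_lt_and_lt one_pos))
  have hcov : ∀ n, ∃ k : ℕ, ∃ F : Fin k → Set X,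
      (∀ i, Metric.ediam (F i) ≤ ENNReal.ofReal (r n)) ∧ E ⊆ ⋃ i, F i ∧
      (k : ℝ≥0∞) ≤ ENNReal.ofReal (r n ^ (-(t : ℝ))) + 1 := by
    intro n
    have hlt : coverNum (r n) E < ENNReal.ofReal (r n ^ (-(t : ℝ))) + 1 :=
      (hrE n).1.trans_lt (ENNReal.lt_add_right ENNReal.ofReal_ne_top one_ne_zero)
    obtain ⟨k, hk⟩ := iInf_lt_iff.1 hlt
    obtain ⟨⟨F, hF, hE⟩, hk⟩ := iInf_lt_iff.1 hk
    exact ⟨k, F, hF, hE, hk.le⟩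
  choose k F hF hE hk using hcov
  refine dimH_le_of_hausdorffMeasure_ne_top (ne_top_of_le_ne_top (b := 2) (by simp) ?_)
  have hr0 : Tendsto (fun n => ENNReal.ofReal (r n)) atTop (𝓝 0) := by
    rw [← ENNReal.ofReal_zero]
    exact (ENNReal.continuous_ofReal.tendsto 0).comp (hr.mono_right nhdsWithin_le_nhds)
  refine (Measure.hausdorffMeasure_le_liminf_sum (t : ℝ) E _ hr0 F
    (Eventually.of_forall hF) (Eventually.of_forall hE)).trans ?_
  refine liminf_le_of_frequently_le (Eventually.of_forall fun n => ?_).frequently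
  obtain ⟨-, h0, h1⟩ := hrE n
  have hp : (0 : ℝ) < r n ^ (t : ℝ) := Real.rpow_pos_of_pos h0 _
  calc ∑ i, Metric.ediam (F n i) ^ (t : ℝ)
      ≤ ∑ _i : Fin (k n), ENNReal.ofReal (r n ^ (t : ℝ)) := by
        refine Finset.sum_le_sum fun i _ => ?_
        rw [← ENNReal.ofReal_rpow_of_pos h0]
        exact ENNReal.rpow_le_rpow (hF n i) t.2
    _ = k n * ENNReal.ofReal (r n ^ (t : ℝ)) := by simp
    _ ≤ (ENNReal.ofReal (r n ^ (-(t : ℝ))) + 1) * ENNReal.ofReal (r n ^ (t : ℝ)) := by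
        gcongr; exact hk n
    _ = 1 + ENNReal.ofReal (r n ^ (t : ℝ)) := by
        rw [add_mul, one_mul, ← ENNReal.ofReal_mul (by positivity), Real.rpow_neg h0.le,
          inv_mul_cancel₀ hp.ne', ENNReal.ofReal_one]
    _ ≤ 1 + 1 := by
        gcongr
        exact ENNReal.ofReal_le_one.2 (Real.rpow_le_one h0.le h1.le t.2)
    _ = 2 := by norm_num

theorem dimH_le_lbdim [MetricSpace X] {E : Set X} (hE : E.Nonempty) :
    (dimH E : EReal) ≤ lbdim E := by
  refine le_of_forall_gt_imp_ge_of_dense fun b hb => ?_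
  obtain ⟨t, ht, htb⟩ := EReal.lt_iff_exists_real_btwn.1 hb
  have ht0 : (0 : ℝ) ≤ t := by exact_mod_cast (lbdim_nonneg hE).trans ht.le
  lift t to ℝ≥0 using ht0
  refine le_trans ?_ htb.le
  have : dimH E ≤ t := by
    refine dimH_le_of_frequently ?_
    refine ((frequently_lt_of_liminf_lt (by isBoundedDefault) ht).and_eventually
      (eventually_zero_lt_and_lt one_pos)).mono fun r ⟨hr, h0, h1⟩ => ?_
    rw [← exp_mul_abs_log h0 h1]
    exact (log_mul_inv_le_iff (abs_pos.2 (Real.log_neg h0 h1).ne)).1 hr.le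
  rw [← EReal.coe_nnreal_eq_coe_real]
  exact_mod_cast this

theorem dimH_le_lpdim [MetricSpace X] {E : Set X} (hE : E.Nonempty) :
    (dimH E : EReal) ≤ lpdim E := by
  refine le_iInf₂ fun G hG => ?_
  have hpos : (0 : EReal) ≤ ⨆ n, lbdim (G n) := by
    obtain ⟨x, hx⟩ := hE
    obtain ⟨n, hn⟩ := mem_iUnion.1 (hG hx)
    exact (lbdim_nonneg ⟨x, hn⟩).trans (le_iSup (fun n => lbdim (G n)) n)
  have hle : dimH E ≤ (⨆ n, lbdim (G n)).toENNReal := by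
    refine (dimH_mono hG).trans ?_
    rw [dimH_iUnion]
    refine iSup_le fun n => ?_
    rcases (G n).eq_empty_or_nonempty with h | h
    · simp [h]
    · rw [← EReal.toENNReal_coe (x := dimH (G n))]
      exact EReal.toENNReal_le_toENNReal
        ((dimH_le_lbdim h).trans (le_iSup (fun n => lbdim (G n)) n))
  calc (dimH E : EReal) ≤ ((⨆ n, lbdim (G n)).toENNReal : EReal) := by exact_mod_cast hle
    _ = _ := EReal.coe_toENNReal hpos

end Dimension

/-! ### Functions of one variable with finite lower scaled oscillation -/

section OneVariable

theorem volume_image_le_of_small_oscillation {u : ℝ → ℝ} {D S : Set ℝ} (hSD : S ⊆ D) (M : ℝ≥0)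
    (h : ∀ x ∈ S, ∀ δ > 0, ∃ r, 0 < r ∧ r < δ ∧ ∀ y ∈ D, |y - x| ≤ r → |u y - u x| ≤ M * r) :
    volume (u '' S) ≤ M * volume S := by
  have key : ∀ ε : ℝ≥0, 0 < ε → volume (u '' S) ≤ M * (volume S + ε) := by
    intro ε hε
    obtain ⟨t, r, htc, htS, hr, hcov, hsum⟩ :=
      Besicovitch.exists_closedBall_covering_tsum_measure_le (volume : Measure ℝ)
        (ε := (ε : ℝ≥0∞)) (by exact_mod_cast hε.ne')
        (fun x => {r | ∀ y ∈ D, |y - x| ≤ r → |u y - u x| ≤ M * r}) S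
        (fun x hx δ hδ => by
          obtain ⟨r, h0, h1, h2⟩ := h x hx δ hδ
          exact ⟨r, h2, h0, h1⟩)
    have hsub : u '' S ⊆ ⋃ x ∈ t, Metric.closedBall (u x) (M * r x) := by
      rintro _ ⟨y, hy, rfl⟩
      obtain ⟨x, hx, hyx⟩ := mem_iUnion₂.1 (hcov hy)
      exact mem_iUnion₂.2 ⟨x, hx, hr x hx y (hSD hy) hyx⟩
    calc volume (u '' S) ≤ volume (⋃ x ∈ t, Metric.closedBall (u x) (M * r x)) :=
          measure_mono hsub
      _ ≤ ∑' x : t, volume (Metric.closedBall (u x) (M * r x)) :=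
          measure_biUnion_le volume htc _
      _ = ∑' x : t, M * volume (Metric.closedBall (x : ℝ) (r x)) := by
          refine tsum_congr fun x => ?_
          rw [Real.volume_closedBall, Real.volume_closedBall, mul_left_comm,
            ENNReal.ofReal_mul M.coe_nonneg, ENNReal.ofReal_coe_nnreal]
      _ = M * ∑' x : t, volume (Metric.closedBall (x : ℝ) (r x)) := ENNReal.tsum_mul_left
      _ ≤ M * (volume S + ε) := by gcongr
  by_cases hS : volume S = ∞
  · rcases eq_or_ne M 0 with rfl | hM
    · simpa using key 1 one_pos
    · simp [hS, ENNReal.mul_top, hM]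
  refine ENNReal.le_of_forall_pos_le_add fun ε hε _ => ?_
  refine (key (ε / (M + 1)) (by positivity)).trans ?_
  rw [mul_add]
  gcongr
  rw [← ENNReal.coe_mul, ENNReal.coe_le_coe, mul_div_left_comm]
  exact mul_le_of_le_one_right' (div_le_one_of_le₀ (by simp) (by positivity))

theorem eq_of_small_oscillation {u : ℝ → ℝ} {a b : ℝ} (hab : a ≤ b)
    (hu : ContinuousOn u (Icc a b)) {N : Set ℝ} (hN : volume N = 0)
    (h0 : ∀ x ∈ Icc a b, x ∉ N → ∀ ε : ℝ≥0, 0 < ε → ∀ δ > 0, ∃ r, 0 < r ∧ r < δ ∧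
      ∀ y ∈ Icc a b, |y - x| ≤ r → |u y - u x| ≤ ε * r)
    (h1 : ∀ x ∈ Icc a b, ∃ k : ℕ, ∀ δ > 0, ∃ r, 0 < r ∧ r < δ ∧
      ∀ y ∈ Icc a b, |y - x| ≤ r → |u y - u x| ≤ k * r) :
    u a = u b := by
  have hgood : volume (u '' (Icc a b \ N)) = 0 := by
    refine le_antisymm (ENNReal.le_of_forall_pos_le_add fun ε hε _ => ?_) zero_le
    have hc : (0 : ℝ≥0) < ε / ((b - a).toNNReal + 1) := by positivity
    refine (volume_image_le_of_small_oscillation sdiff_subset (ε / ((b - a).toNNReal + 1))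
      fun x hx => h0 x hx.1 hx.2 _ hc).trans ?_
    calc ((ε / ((b - a).toNNReal + 1) : ℝ≥0) : ℝ≥0∞) * volume (Icc a b \ N)
        ≤ ((ε / ((b - a).toNNReal + 1) : ℝ≥0) : ℝ≥0∞) * ((b - a).toNNReal : ℝ≥0) := by
          gcongr
          exact (measure_mono sdiff_subset).trans (by rw [Real.volume_Icc]; rfl)
      _ ≤ 0 + ε := by
          rw [zero_add, ← ENNReal.coe_mul, ENNReal.coe_le_coe, div_mul_eq_mul_div, mul_div_assoc]
          exact mul_le_of_le_one_right' (div_le_one_of_le₀ (by simp) (by positivity))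
  have hbad : ∀ k : ℕ, volume (u '' {x ∈ Icc a b ∩ N | ∀ δ > 0, ∃ r, 0 < r ∧ r < δ ∧
      ∀ y ∈ Icc a b, |y - x| ≤ r → |u y - u x| ≤ k * r}) = 0 := by
    intro k
    refine le_antisymm ((volume_image_le_of_small_oscillation (D := Icc a b)
      (fun x hx => hx.1.1) (k : ℝ≥0) fun x hx => by simpa using hx.2).trans ?_) zero_le
    rw [measure_mono_null (fun x hx => hx.1.2) hN, mul_zero]
  have hvol : volume (u '' Icc a b) = 0 := by
    refine measure_mono_null (t := u '' (Icc a b \ N) ∪ ⋃ k : ℕ, u '' {x ∈ Icc a b ∩ N |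
      ∀ δ > 0, ∃ r, 0 < r ∧ r < δ ∧ ∀ y ∈ Icc a b, |y - x| ≤ r → |u y - u x| ≤ k * r}) ?_
      (measure_union_null hgood (measure_iUnion_null hbad))
    rintro _ ⟨x, hx, rfl⟩
    by_cases hxN : x ∈ N
    · obtain ⟨k, hk⟩ := h1 x hx
      exact Or.inr (mem_iUnion.2 ⟨k, x, ⟨⟨hx, hxN⟩, hk⟩, rfl⟩)
    · exact Or.inl ⟨x, ⟨hx, hxN⟩, rfl⟩
  have hsub : uIcc (u a) (u b) ⊆ u '' Icc a b := by
    have := intermediate_value_uIcc (a := a) (b := b) (f := u) (by rwa [uIcc_of_le hab])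
    rwa [uIcc_of_le hab] at this
  have := measure_mono_null hsub hvol
  rw [Real.volume_interval, ENNReal.ofReal_eq_zero] at this
  exact (sub_eq_zero.1 (abs_eq_zero.1 (le_antisymm this (abs_nonneg _)))).symm

end OneVariable

/-! ### Lower bound: points with infinite lower scaled oscillation -/

section LowerBound

theorem exists_radius_of_lipGauge_lt {X : Type*} [PseudoMetricSpace X] {f : X → ℝ} {x : X}
    {M : ℝ≥0} (h : lipGauge (fun r => r) f x < M) {δ : ℝ} (hδ : 0 < δ) :
    ∃ r, 0 < r ∧ r < δ ∧ ∀ y, dist y x ≤ r → |f y - f x| ≤ M * r := by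
  obtain ⟨r, hr, h0, hrδ⟩ := ((frequently_lt_of_liminf_lt (by isBoundedDefault) h).and_eventually
    (eventually_zero_lt_and_lt hδ)).exists
  refine ⟨r, h0, hrδ, fun y hy => ?_⟩
  have hle : Metric.ediam (f '' Metric.closedBall x r) ≤ M * ENNReal.ofReal r :=
    (ENNReal.div_le_iff (by simpa using h0) ENNReal.ofReal_ne_top).1 hr.le
  have hd : edist (f y) (f x) ≤ M * ENNReal.ofReal r :=
    (Metric.edist_le_ediam_of_mem (mem_image_of_mem f hy)
      (mem_image_of_mem f (Metric.mem_closedBall_self h0.le))).trans hle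
  rw [edist_dist, Real.dist_eq, ← ENNReal.ofReal_coe_nnreal, ← ENNReal.ofReal_mul M.coe_nonneg]
    at hd
  exact (ENNReal.ofReal_le_ofReal_iff (by positivity)).1 hd

variable {m : ℕ}

/-- The point of `ℝ^(m+1)` with first coordinate `t` and remaining coordinates `y`. -/
def consPoint (t : ℝ) (y : Fin m → ℝ) : EuclideanSpace ℝ (Fin (m + 1)) :=
  WithLp.toLp 2 (Fin.cons t y)

theorem dist_consPoint (s t : ℝ) (y : Fin m → ℝ) :
    dist (consPoint s y) (consPoint t y) = |s - t| := by
  simp [consPoint, EuclideanSpace.dist_eq, Fin.sum_univ_succ, Real.sqrt_sq_eq_abs, Real.dist_eq]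

theorem continuous_consPoint :
    Continuous fun p : ℝ × (Fin m → ℝ) => consPoint p.1 p.2 := by
  refine (PiLp.continuous_toLp 2 _).comp (continuous_pi fun i => ?_)
  refine Fin.cases ?_ (fun j => ?_) i
  · simpa using continuous_fst
  · simpa [Function.comp_def] using (continuous_apply j).comp continuous_snd

/-- The projection of `ℝ^(m+1)` forgetting the first coordinate. -/
def tailCoord (x : EuclideanSpace ℝ (Fin (m + 1))) : Fin m → ℝ := fun j => x j.succ

theorem lipschitzWith_tailCoord : LipschitzWith 1 (tailCoord (m := m)) := by
  refine LipschitzWith.of_dist_le_mul fun x y => ?_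
  rw [NNReal.coe_one, one_mul]
  refine (dist_pi_le_iff dist_nonneg).2 fun j => ?_
  exact PiLp.dist_apply_le x y j.succ

theorem tailCoord_consPoint (t : ℝ) (y : Fin m → ℝ) : tailCoord (consPoint t y) = y := rfl

theorem measurePreserving_consPoint :
    MeasurePreserving (fun p : ℝ × (Fin m → ℝ) => consPoint p.1 p.2) volume volume := by
  have h1 := (volume_preserving_piFinSuccAbove (fun _ : Fin (m + 1) => ℝ) 0).symm
  have h2 := (PiLp.volume_preserving_toLp (Fin (m + 1))).comp h1
  have h3 : (fun p : ℝ × (Fin m → ℝ) => consPoint p.1 p.2) =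
      WithLp.toLp 2 ∘ (MeasurableEquiv.piFinSuccAbove (fun _ : Fin (m + 1) => ℝ) 0).symm := by
    funext p
    simp [consPoint, MeasurableEquiv.piFinSuccAbove, Fin.insertNthEquiv]
  rw [h3]
  exact h2

theorem ae_ae_consPoint {N : Set (EuclideanSpace ℝ (Fin (m + 1)))} (hN : volume N = 0) :
    ∀ᵐ y : Fin m → ℝ, ∀ᵐ t : ℝ, consPoint t y ∉ N := by
  have h1 : ∀ᵐ x, x ∉ N := measure_eq_zero_iff_ae_notMem.1 hN
  have h2 := measurePreserving_consPoint.quasiMeasurePreserving.ae h1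
  have h3 := (Measure.measurePreserving_swap
    (μ := (volume : Measure (Fin m → ℝ))) (ν := (volume : Measure ℝ))).quasiMeasurePreserving.ae h2
  exact Measure.ae_ae_of_ae_prod h3

variable {Ω : Set (EuclideanSpace ℝ (Fin (m + 1)))}

theorem volume_tailCoord_image_ne_zero (hopen : IsOpen Ω) (f : C(↥Ω, ℝ))
    (hN : volume {x | ∃ hx : x ∈ Ω, lipGauge (fun r => r) (⇑f) ⟨x, hx⟩ ≠ 0} = 0)
    {a b : ℝ} (hab : a ≤ b) {y₀ : Fin m → ℝ} (hseg : ∀ t ∈ Icc a b, consPoint t y₀ ∈ Ω)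
    (hne : f ⟨consPoint a y₀, hseg a (left_mem_Icc.2 hab)⟩ ≠
      f ⟨consPoint b y₀, hseg b (right_mem_Icc.2 hab)⟩) :
    volume (tailCoord '' {x | ∃ hx : x ∈ Ω, lipGauge (fun r => r) (⇑f) ⟨x, hx⟩ = ⊤}) ≠ 0 := by
  intro hzero
  set F : EuclideanSpace ℝ (Fin (m + 1)) → ℝ := Function.extend Subtype.val f 0 with hF
  have hFf : ∀ x (hx : x ∈ Ω), F x = f ⟨x, hx⟩ := fun x hx =>
    Subtype.val_injective.extend_apply f 0 ⟨x, hx⟩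
  have hFc : ContinuousOn F Ω := by
    rw [continuousOn_iff_continuous_domRestrict]
    convert f.continuous using 1
    funext x
    exact hFf x x.2
  have hsegV : ∀ᶠ y in 𝓝 y₀, ∀ t ∈ Icc a b, consPoint t y ∈ Ω := by
    refine isCompact_Icc.eventually_forall_of_forall_eventually fun t ht => ?_
    exact ((continuous_consPoint.comp continuous_swap).tendsto (y₀, t)).eventually
      (hopen.mem_nhds (hseg t ht))
  have hcont : ∀ t ∈ Icc a b, ContinuousAt (fun y => F (consPoint t y)) y₀ := fun t ht =>
    ContinuousAt.comp (f := fun y => consPoint t y) (hFc.continuousAt (hopen.mem_nhds (hseg t ht)))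
      (continuous_consPoint.comp (Continuous.prodMk_right t)).continuousAt
  have hneV : ∀ᶠ y in 𝓝 y₀, F (consPoint a y) ≠ F (consPoint b y) := by
    refine ((hcont a (left_mem_Icc.2 hab)).ne_iff_eventually_ne
      (hcont b (right_mem_Icc.2 hab))).1 ?_
    rwa [hFf _ (hseg _ (left_mem_Icc.2 hab)), hFf _ (hseg _ (right_mem_Icc.2 hab))]
  have hdense := Measure.dense_of_ae
    ((measure_eq_zero_iff_ae_notMem.1 hzero).and (ae_ae_consPoint hN))
  obtain ⟨y, ⟨hyE, hyN⟩, hyΩ, hyne⟩ := hdense.inter_nhds_nonempty (hsegV.and hneV)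
  have hyN' : volume {t | ∃ hx : consPoint t y ∈ Ω,
      lipGauge (fun r => r) (⇑f) ⟨consPoint t y, hx⟩ ≠ 0} = 0 :=
    measure_eq_zero_iff_ae_notMem.2 hyN
  refine hyne (eq_of_small_oscillation hab (u := fun t => F (consPoint t y)) ?_ hyN' ?_ ?_)
  · exact hFc.comp (continuous_consPoint.comp (Continuous.prodMk_left y)).continuousOn hyΩ
  · intro x hx hxN ε hε δ hδ
    have h0 : lipGauge (fun r => r) (⇑f) ⟨_, hyΩ x hx⟩ = 0 := by
      by_contra h
      exact hxN ⟨hyΩ x hx, h⟩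
    obtain ⟨r, hr0, hrδ, hr⟩ := exists_radius_of_lipGauge_lt (M := ε)
      (by rw [h0]; exact_mod_cast hε) hδ
    refine ⟨r, hr0, hrδ, fun s hs hsx => ?_⟩
    rw [hFf _ (hyΩ s hs), hFf _ (hyΩ x hx)]
    exact hr _ (by rwa [Subtype.dist_eq, dist_consPoint])
  · intro x hx
    have htop : lipGauge (fun r => r) (⇑f) ⟨_, hyΩ x hx⟩ ≠ ⊤ := fun h =>
      hyE ⟨consPoint x y, ⟨hyΩ x hx, h⟩, tailCoord_consPoint x y⟩
    obtain ⟨k, hk⟩ := ENNReal.exists_nat_gt htop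
    refine ⟨k, fun δ hδ => ?_⟩
    obtain ⟨r, hr0, hrδ, hr⟩ := exists_radius_of_lipGauge_lt (M := k) (by exact_mod_cast hk) hδ
    refine ⟨r, hr0, hrδ, fun s hs hsx => ?_⟩
    rw [hFf _ (hyΩ s hs), hFf _ (hyΩ x hx)]
    exact hr _ (by rwa [Subtype.dist_eq, dist_consPoint])

theorem le_dimH_of_volume_tailCoord_image_ne_zero {E : Set (EuclideanSpace ℝ (Fin (m + 1)))}
    (hE : volume (tailCoord '' E) ≠ 0) : (m : ℝ≥0∞) ≤ dimH E := by
  by_contra! h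
  refine hE ?_
  have h1 : dimH (tailCoord '' E) < ((m : ℝ≥0) : ℝ≥0∞) := by
    simpa using (lipschitzWith_tailCoord.dimH_image_le E).trans_lt h
  have h2 := hausdorffMeasure_of_dimH_lt h1
  have h3 := hausdorffMeasure_pi_real (ι := Fin m)
  rw [Fintype.card_fin] at h3
  rw [← h3]
  exact_mod_cast h2

end LowerBound

/-! ### Residual sets of continuous functions -/

section Residual

theorem mem_residual_of_approx {X : Type*} [TopologicalSpace X] {S : Set C(X, ℝ)}
    (h : ∀ (f : C(X, ℝ)) (K : Set X), IsCompact K → ∀ ε > 0, ∃ g : C(X, ℝ),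
      (∀ x ∈ K, |f x - g x| < ε) ∧ ∃ K' : Set X, IsCompact K' ∧ ∃ δ > 0,
        ∀ u : C(X, ℝ), (∀ x ∈ K', |g x - u x| < δ) → u ∈ S) :
    S ∈ residual C(X, ℝ) := by
  have hb : ∀ f : C(X, ℝ), (𝓝 f).HasBasis (fun p : Set X × ℝ => IsCompact p.1 ∧ 0 < p.2)
      fun p => {g | ∀ x ∈ p.1, |f x - g x| < p.2} := fun f => by
    simpa [UniformSpace.ball, Real.dist_eq] using nhds_basis_uniformity'
      (Filter.HasBasis.compactConvergenceUniformity (α := X) (Metric.uniformity_basis_dist (α := ℝ)))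
      (x := f)
  refine mem_of_superset (residual_of_dense_open (s := interior S) isOpen_interior ?_)
    interior_subset
  intro f
  rw [mem_closure_iff_nhds_basis (hb f)]
  rintro ⟨K, ε⟩ ⟨hK, hε⟩
  obtain ⟨g, hg, K', hK', δ, hδ, hS⟩ := h f K hK ε hε
  exact ⟨g, mem_interior_iff_mem_nhds.2 ((hb g).mem_iff.2 ⟨(K', δ), ⟨hK', hδ⟩, hS⟩), hg⟩

theorem eventually_residual_apply_ne {X : Type*} [MetricSpace X] {a b : X} (hab : a ≠ b) :
    ∀ᶠ f : C(X, ℝ) in residual C(X, ℝ), f a ≠ f b := by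
  refine mem_residual_of_approx fun f K _ ε hε => ?_
  have hg : ∃ g : C(X, ℝ), (∀ x ∈ K, |f x - g x| < ε) ∧ g a ≠ g b := by
    by_cases hf : f a = f b
    · refine ⟨⟨fun x => f x + ε / 2 * min 1 (dist x a), by fun_prop⟩, fun x _ => ?_, ?_⟩
      · have h0 : 0 ≤ min 1 (dist x a) := le_min zero_le_one dist_nonneg
        have h1 : min 1 (dist x a) ≤ 1 := min_le_left _ _
        simp only [ContinuousMap.coe_mk]
        rw [abs_lt]
        constructor <;> nlinarith
      · have h0 : 0 < min 1 (dist b a) := lt_min one_pos (dist_pos.2 hab.symm)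
        simp only [ContinuousMap.coe_mk, dist_self, hf]
        simp [hε.ne', h0.ne']
    · exact ⟨f, fun x _ => by simpa using hε, hf⟩
  obtain ⟨g, hg, hne⟩ := hg
  refine ⟨g, hg, {a, b}, (toFinite _).isCompact, |g a - g b| / 2,
    half_pos (abs_pos.2 (sub_ne_zero.2 hne)), fun u hu => ?_⟩
  have ha := hu a (by simp)
  have hb := hu b (by simp)
  intro h
  have := abs_sub_le (g a) (u a) (g b)
  rw [h, abs_sub_comm (u b)] at this
  rw [h] at ha
  linarith

variable {d : ℕ} {Ω : Set (EuclideanSpace ℝ (Fin d))}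

theorem isCompact_closedBall_of_subset {c : Ω} {R : ℝ}
    (h : Metric.closedBall (c : EuclideanSpace ℝ (Fin d)) R ⊆ Ω) :
    IsCompact (Metric.closedBall c R) := by
  rw [Subtype.isCompact_iff]
  have heq : Subtype.val '' Metric.closedBall c R =
      Metric.closedBall (c : EuclideanSpace ℝ (Fin d)) R := by
    ext x
    constructor
    · rintro ⟨y, hy, rfl⟩
      exact hy
    · intro hx
      exact ⟨⟨x, h hx⟩, hx, rfl⟩
  rw [heq]
  exact isCompact_closedBall _ _

theorem eventually_residual_large_oscillation (hd : 0 < d) {c : Ω} {ρ : ℝ} (hρ : 0 < ρ)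
    (hc : Metric.closedBall (c : EuclideanSpace ℝ (Fin d)) (2 * ρ) ⊆ Ω) {b : ℝ} (hb : 0 < b) :
    ∀ᶠ f : C(Ω, ℝ) in residual C(Ω, ℝ), ∀ x ∈ Metric.closedBall c ρ, ∃ r, 0 < r ∧ r < b ∧
      ENNReal.ofReal r ≤ Metric.ediam (f '' Metric.closedBall x r) := by
  refine mem_residual_of_approx fun f K _ ε hε => ?_
  have hB := isCompact_closedBall_of_subset hc
  obtain ⟨η, hη, hfη⟩ := Metric.uniformContinuousOn_iff.1
    (hB.uniformContinuousOn_of_continuous f.continuous.continuousOn) (ε / 4) (by positivity)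
  obtain ⟨r, hr0, hr⟩ := exists_between (a₁ := 0) (a₂ := min (min b η) (min ρ (ε / 2)))
    (by positivity)
  simp only [lt_min_iff] at hr
  obtain ⟨⟨hrb, hrη⟩, hrρ, hrε⟩ := hr
  let i : Fin d := ⟨0, hd⟩
  refine ⟨⟨fun x => f x + ε / 2 * Real.cos (2 * Real.pi * ((x : EuclideanSpace ℝ (Fin d)) i / r)),
    by fun_prop⟩, fun x _ => ?_, Metric.closedBall c (2 * ρ), hB, ε / 8, by positivity,
    fun u hu x hx => ⟨r, hr0, hrb, ?_⟩⟩
  · have h0 := Real.abs_cos_le_one (2 * Real.pi * ((x : EuclideanSpace ℝ (Fin d)) i / r))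
    simp only [ContinuousMap.coe_mk, sub_add_cancel_left, abs_neg, abs_mul]
    rw [abs_of_pos (half_pos hε)]
    nlinarith
  · set k : ℤ := round ((x : EuclideanSpace ℝ (Fin d)) i / r) with hk
    have hkr : |k * r - (x : EuclideanSpace ℝ (Fin d)) i| ≤ r / 2 := by
      have h1 := abs_sub_round ((x : EuclideanSpace ℝ (Fin d)) i / r)
      have h2 : (k * r - (x : EuclideanSpace ℝ (Fin d)) i) =
          -(((x : EuclideanSpace ℝ (Fin d)) i / r - k) * r) := by field_simp; ring
      rw [h2, abs_neg, abs_mul, abs_of_pos hr0]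
      nlinarith
    have hmem : ∀ s : ℝ, |s| ≤ r → ∃ p : Ω, p ∈ Metric.closedBall x r ∧
        p ∈ Metric.closedBall c (2 * ρ) ∧
        (p : EuclideanSpace ℝ (Fin d)) = (x : EuclideanSpace ℝ (Fin d)) + EuclideanSpace.single i s := by
      intro s hs
      have hpx : dist ((x : EuclideanSpace ℝ (Fin d)) + EuclideanSpace.single i s) x ≤ r := by
        simpa [dist_eq_norm] using hs
      have hpc : dist ((x : EuclideanSpace ℝ (Fin d)) + EuclideanSpace.single i s) c ≤ 2 * ρ := by
        have h1 := dist_triangle ((x : EuclideanSpace ℝ (Fin d)) + EuclideanSpace.single i s) x c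
        have h2 : dist (x : EuclideanSpace ℝ (Fin d)) c ≤ ρ := hx
        linarith
      exact ⟨⟨_, hc hpc⟩, hpx, hpc, rfl⟩
    obtain ⟨p, hpx, hpc, hp⟩ := hmem (k * r - (x : EuclideanSpace ℝ (Fin d)) i) (by linarith)
    obtain ⟨q, hqx, hqc, hq⟩ := hmem (k * r - (x : EuclideanSpace ℝ (Fin d)) i + r / 2) (by
      refine (abs_add_le _ _).trans ?_
      rw [abs_of_pos (half_pos hr0)]
      linarith)
    have hpq : dist p q < η := by
      rw [Subtype.dist_eq, hp, hq, dist_add_left, PiLp.dist_single_same, Real.dist_eq,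
        sub_add_cancel_left, abs_neg, abs_of_pos (half_pos hr0)]
      linarith
    have hpi : Real.cos (2 * Real.pi * ((p : EuclideanSpace ℝ (Fin d)) i / r)) = 1 := by
      have : 2 * Real.pi * ((p : EuclideanSpace ℝ (Fin d)) i / r) = k * (2 * Real.pi) := by
        rw [hp]; simp; field_simp
      rw [this, Real.cos_int_mul_two_pi]
    have hqi : Real.cos (2 * Real.pi * ((q : EuclideanSpace ℝ (Fin d)) i / r)) = -1 := by
      have : 2 * Real.pi * ((q : EuclideanSpace ℝ (Fin d)) i / r) = k * (2 * Real.pi) + Real.pi := by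
        rw [hq]; simp; field_simp; ring
      rw [this, Real.cos_int_mul_two_pi_add_pi]
    have h1 := abs_lt.1 (hfη p hpc q hqc hpq)
    have h2 := abs_lt.1 (hu p hpc)
    have h3 := abs_lt.1 (hu q hqc)
    simp only [ContinuousMap.coe_mk, hpi, hqi] at h2 h3
    refine le_trans ?_ (Metric.edist_le_ediam_of_mem (mem_image_of_mem u hpx)
      (mem_image_of_mem u hqx))
    rw [edist_dist, Real.dist_eq]
    refine ENNReal.ofReal_le_ofReal (le_trans ?_ (le_abs_self _))
    linarith

theorem LipGauge_ne_zero {X : Type*} [PseudoMetricSpace X] {f : X → ℝ} {x : X}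
    (h : ∀ n : ℕ, ∃ r, 0 < r ∧ r < 1 / ((n : ℝ) + 1) ∧
      ENNReal.ofReal r ≤ Metric.ediam (f '' Metric.closedBall x r)) :
    LipGauge (fun r => r) f x ≠ 0 := by
  refine (one_pos.trans_le (le_limsup_of_frequently_le ?_ (by isBoundedDefault))).ne'
  rw [(nhdsGT_basis (0 : ℝ)).frequently_iff]
  intro b hb
  obtain ⟨n, hn⟩ := exists_nat_one_div_lt hb
  obtain ⟨r, h0, h1, hr⟩ := h n
  exact ⟨r, ⟨h0, h1.trans hn⟩,
    (ENNReal.le_div_iff_mul_le (by simp [h0]) (by simp)).2 (by rw [one_mul]; exact hr)⟩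

end Residual

/-! ### Staircase approximations -/

section Staircase

/-- A continuous staircase with steps at the integers: it is constant except on the intervals
`[k, k + η]`, `k ∈ ℤ`. -/
noncomputable def stair (η t : ℝ) : ℝ := ⌊t⌋ + min 1 (Int.fract t / η)

theorem continuous_stair {η : ℝ} (hη0 : 0 < η) (hη1 : η ≤ 1) : Continuous (stair η) := by
  have h : Continuous ((fun τ : ℝ => min 1 (τ / η) - τ) ∘ Int.fract) := by
    refine ContinuousOn.comp_fract'' (by fun_prop) ?_
    rw [min_eq_left ((one_le_div hη0).2 hη1)]
    simp
  convert continuous_id.add h using 1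
  funext t
  simp only [stair, Pi.add_apply, id, Function.comp_apply]
  rw [← Int.self_sub_fract t]
  ring

theorem abs_stair_sub_le {η : ℝ} (hη0 : 0 < η) (t : ℝ) : |stair η t - t| ≤ 1 := by
  have h1 : 0 ≤ min 1 (Int.fract t / η) := le_min zero_le_one (div_nonneg (Int.fract_nonneg t) hη0.le)
  have h2 : min 1 (Int.fract t / η) ≤ 1 := min_le_left _ _
  have h3 := Int.fract_nonneg t
  have h4 := (Int.fract_lt_one t).le
  have h5 := Int.self_sub_fract t
  rw [abs_le, stair, ← h5]
  constructor <;> linarith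

theorem stair_eq_of_far {η t t' : ℝ} (hη0 : 0 < η) (h : ∀ k : ℤ, 2 * η < |t - k|)
    (ht : |t' - t| ≤ η) : stair η t' = stair η t := by
  have h1 := h ⌊t⌋
  have h2 := h (⌊t⌋ + 1)
  have h3 := Int.floor_le t
  have h4 := (Int.lt_floor_add_one t).le
  push_cast at h2
  rw [abs_of_nonneg (by linarith)] at h1
  rw [abs_of_nonpos (by linarith)] at h2
  obtain ⟨h5, h6⟩ := abs_le.1 ht
  have hfl : ⌊t'⌋ = ⌊t⌋ := Int.floor_eq_iff.2 ⟨by linarith, by linarith⟩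
  have hmin : ∀ s : ℝ, ⌊t⌋ + η ≤ s → ⌊s⌋ = ⌊t⌋ → min 1 (Int.fract s / η) = 1 := fun s hs hsf => by
    refine min_eq_left ((one_le_div hη0).2 ?_)
    rw [← Int.self_sub_floor, hsf]
    linarith
  rw [stair, stair, hmin t' (by linarith) hfl, hmin t (by linarith) rfl, hfl]

theorem EuclideanSpace.dist_le_mul_of_forall {d : ℕ} {x y : EuclideanSpace ℝ (Fin d)} {a : ℝ}
    (ha : 0 ≤ a) (h : ∀ i, |x i - y i| ≤ a) : dist x y ≤ d * a := by
  rw [EuclideanSpace.dist_eq]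
  refine Real.sqrt_le_iff.2 ⟨by positivity, ?_⟩
  calc ∑ i, dist (x i) (y i) ^ 2 ≤ ∑ _i : Fin d, a ^ 2 :=
        Finset.sum_le_sum fun i _ => by
          rw [Real.dist_eq]
          exact pow_le_pow_left₀ (abs_nonneg _) (h i) 2
    _ = d * a ^ 2 := by simp
    _ ≤ (d * a) ^ 2 := by
        rw [mul_pow]
        gcongr
        exact_mod_cast Nat.le_self_pow two_ne_zero d

/-- The staircase map of `ℝ^d` with step size `1 / p`, acting on each coordinate. -/
noncomputable def stairMap {d : ℕ} (p : ℕ) (η : ℝ) (x : EuclideanSpace ℝ (Fin d)) :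
    EuclideanSpace ℝ (Fin d) :=
  WithLp.toLp 2 fun i => stair η (p * x i) / p

theorem continuous_stairMap {d p : ℕ} {η : ℝ} (hη0 : 0 < η) (hη1 : η ≤ 1) :
    Continuous (stairMap (d := d) p η) := by
  have := continuous_stair hη0 hη1
  refine (PiLp.continuous_toLp 2 _).comp ?_
  fun_prop

theorem dist_stairMap_le {d p : ℕ} (hp : 0 < p) {η : ℝ} (hη0 : 0 < η)
    (x : EuclideanSpace ℝ (Fin d)) : dist (stairMap p η x) x ≤ d / p := by
  have hp' : (0 : ℝ) < p := by exact_mod_cast hp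
  rw [div_eq_mul_one_div]
  refine EuclideanSpace.dist_le_mul_of_forall (by positivity) fun i => ?_
  have h1 := abs_stair_sub_le hη0 (p * x i)
  have h2 : stair η (p * x i) / p - x i = (stair η (p * x i) - p * x i) / p := by field_simp
  simp only [stairMap]
  rw [h2, abs_div, abs_of_pos hp']
  gcongr

/-- Points of which some coordinate is within `2 / q` of a multiple of `1 / p`. -/
def gridNhd (d p q : ℕ) : Set (EuclideanSpace ℝ (Fin d)) :=
  {x | ∃ i, ∃ k : ℤ, |x i - k / p| ≤ 2 / q}

theorem stairMap_eq_of_notMem_gridNhd {d p q : ℕ} (hp : 0 < p) (hq : 0 < q)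
    {x y : EuclideanSpace ℝ (Fin d)} (hx : x ∉ gridNhd d p q) (hxy : dist y x ≤ 1 / q) :
    stairMap p (p / q) y = stairMap p (p / q) x := by
  have hp' : (0 : ℝ) < p := by exact_mod_cast hp
  have hq' : (0 : ℝ) < q := by exact_mod_cast hq
  have key : ∀ i, stair (p / q : ℝ) (p * y i) = stair (p / q : ℝ) (p * x i) := fun i => by
    refine stair_eq_of_far (by positivity) (fun k => ?_) ?_
    · have h1 : 2 / (q : ℝ) < |x i - k / p| := by
        by_contra! h
        exact hx ⟨i, k, h⟩
      have h2 : p * x i - k = p * (x i - k / p) := by field_simp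
      rw [h2, abs_mul, abs_of_pos hp']
      calc 2 * ((p : ℝ) / q) = p * (2 / q) := by ring
        _ < _ := by gcongr
    · rw [← mul_sub, abs_mul, abs_of_pos hp', div_eq_mul_one_div]
      gcongr
      exact (PiLp.dist_apply_le y x i).trans hxy
  simp only [stairMap, key]

theorem coverNum_gridNhd_le {m p q R : ℕ} (hp : 0 < p) (hq : 0 < q) :
    coverNum (1 / q : ℝ) (Metric.closedBall (0 : EuclideanSpace ℝ (Fin (m + 1))) R ∩
      gridNhd (m + 1) p q) ≤
      (((m + 1) * (2 * (p * (R + 2)) + 1) * (4 * (m + 1) + 2) *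
        (2 * (R * ((m + 1) * q)) + 1) ^ m : ℕ) : ℝ≥0∞) := by
  have hp' : (0 : ℝ) < p := by exact_mod_cast hp
  have hq' : (0 : ℝ) < q := by exact_mod_cast hq
  have hq1 : (1 : ℝ) ≤ q := by exact_mod_cast hq
  set D : ℝ := ((m + 1 : ℕ) : ℝ) with hD
  have hD0 : 0 < D := by rw [hD]; positivity
  set P : ℤ := ((p * (R + 2) : ℕ) : ℤ) with hP
  set W : ℤ := ((2 * (m + 1) : ℕ) : ℤ) with hW
  set T : ℤ := ((R * ((m + 1) * q) : ℕ) : ℤ) with hT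
  let F : Fin (m + 1) × Finset.Icc (-P) P × Finset.Icc (-W) (W + 1) ×
      (Fin m → Finset.Icc (-T) T) → Set (EuclideanSpace ℝ (Fin (m + 1))) := fun z =>
    {x | ⌊x z.1 * (D * q)⌋ = ⌊(z.2.1 : ℤ) / (p : ℝ) * (D * q)⌋ + z.2.2.1 ∧
      ∀ j, ⌊x (z.1.succAbove j) * (D * q)⌋ = z.2.2.2 j}
  have hcard : Fintype.card (Fin (m + 1) × Finset.Icc (-P) P × Finset.Icc (-W) (W + 1) ×
      (Fin m → Finset.Icc (-T) T)) = (m + 1) * (2 * (p * (R + 2)) + 1) * (4 * (m + 1) + 2) *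
        (2 * (R * ((m + 1) * q)) + 1) ^ m := by
    simp only [Fintype.card_prod, Fintype.card_fin, Fintype.card_pi, Fintype.card_coe,
      Int.card_Icc, Finset.prod_const, Finset.card_univ]
    have h1 : (P + 1 - -P).toNat = 2 * (p * (R + 2)) + 1 := by omega
    have h2 : (W + 1 + 1 - -W).toNat = 4 * (m + 1) + 2 := by omega
    have h3 : (T + 1 - -T).toNat = 2 * (R * ((m + 1) * q)) + 1 := by omega
    rw [h1, h2, h3]
    ring
  rw [← hcard]
  refine coverNum_le_card F (fun z => ?_) ?_
  · refine Metric.ediam_le fun x hx y hy => ?_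
    rw [edist_dist]
    refine ENNReal.ofReal_le_ofReal ?_
    have h1 : dist x y ≤ (m + 1 : ℕ) * (1 / (D * q)) := by
      refine EuclideanSpace.dist_le_mul_of_forall (by positivity) ?_
      have h2 : ∀ i, ⌊x i * (D * q)⌋ = ⌊y i * (D * q)⌋ := by
        rw [Fin.forall_iff_succAbove z.1]
        exact ⟨hx.1.trans hy.1.symm, fun j => (hx.2 j).trans (hy.2 j).symm⟩
      intro i
      have h3 := (Int.abs_sub_lt_one_of_floor_eq_floor (h2 i)).le
      rw [← sub_mul, abs_mul, abs_of_pos (by positivity : 0 < D * q)] at h3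
      rwa [le_div_iff₀ (by positivity)]
    refine h1.trans_eq ?_
    rw [← hD]
    field_simp
  · rintro x ⟨hxR, i, k, hik⟩
    have hxj : ∀ j, |x j| ≤ R := fun j =>
      (PiLp.norm_apply_le x j).trans (by simpa using hxR)
    have hkR : |(k : ℝ) / p| ≤ R + 2 := by
      have h1 := abs_sub_abs_le_abs_sub ((k : ℝ) / p) (x i)
      have h2 : 2 / (q : ℝ) ≤ 2 := div_le_self (by norm_num) hq1
      have h3 := hxj i
      rw [abs_sub_comm] at h1
      linarith
    have hkP : k ∈ Finset.Icc (-P) P := by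
      rw [abs_div, abs_of_pos hp', div_le_iff₀ hp'] at hkR
      have : |k| ≤ P := by
        have h1 : ((|k| : ℤ) : ℝ) ≤ (P : ℤ) := by
          rw [hP]; push_cast; linarith
        exact_mod_cast h1
      exact Finset.mem_Icc.2 (abs_le.1 this)
    have hdiff : |x i * (D * q) - (k : ℝ) / p * (D * q)| ≤ W := by
      rw [← sub_mul, abs_mul, abs_of_pos (by positivity : 0 < D * q)]
      calc |x i - k / p| * (D * q) ≤ 2 / q * (D * q) := by gcongr
        _ = W := by rw [hW, hD]; push_cast; field_simp
    have hwW : ⌊x i * (D * q)⌋ - ⌊(k : ℝ) / p * (D * q)⌋ ∈ Finset.Icc (-W) (W + 1) := by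
      obtain ⟨h1, h2⟩ := abs_le.1 hdiff
      have h3 := Int.floor_le (x i * (D * q))
      have h4 := Int.lt_floor_add_one (x i * (D * q))
      have h5 := Int.floor_le ((k : ℝ) / p * (D * q))
      have h6 := Int.lt_floor_add_one ((k : ℝ) / p * (D * q))
      have h7 : -W - 1 < ⌊x i * (D * q)⌋ - ⌊(k : ℝ) / p * (D * q)⌋ := by
        have : ((-W - 1 : ℤ) : ℝ) < (⌊x i * (D * q)⌋ - ⌊(k : ℝ) / p * (D * q)⌋ : ℤ) := by
          push_cast; linarith
        exact_mod_cast this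
      have h8 : ⌊x i * (D * q)⌋ - ⌊(k : ℝ) / p * (D * q)⌋ < W + 1 := by
        have : ((⌊x i * (D * q)⌋ - ⌊(k : ℝ) / p * (D * q)⌋ : ℤ) : ℝ) < (W + 1 : ℤ) := by
          push_cast; linarith
        exact_mod_cast this
      exact Finset.mem_Icc.2 ⟨by omega, by omega⟩
    have hvT : ∀ j, ⌊x j * (D * q)⌋ ∈ Finset.Icc (-T) T := fun j => by
      have h1 : |x j * (D * q)| ≤ T := by
        rw [abs_mul, abs_of_pos (by positivity : 0 < D * q), hT]
        push_cast
        have := hxj j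
        rw [hD]
        push_cast
        gcongr
      obtain ⟨h2, h3⟩ := abs_le.1 h1
      refine Finset.mem_Icc.2 ⟨Int.le_floor.2 (by push_cast; exact h2), ?_⟩
      exact Int.cast_le.1 ((Int.floor_le _).trans h3)
    refine mem_iUnion.2 ⟨(i, ⟨k, hkP⟩, ⟨_, hwW⟩, fun j => ⟨_, hvT (i.succAbove j)⟩), ?_, fun j => rfl⟩
    simp

theorem exists_coverNum_gridNhd_le (m p R : ℕ) (hp : 0 < p) {s : ℝ} (hs : 0 < s) :
    ∀ᶠ q : ℕ in atTop,
      coverNum (1 / q : ℝ) (Metric.closedBall (0 : EuclideanSpace ℝ (Fin (m + 1))) R ∩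
        gridNhd (m + 1) p q) ≤ ENNReal.ofReal ((1 / q : ℝ) ^ (-(m + s))) := by
  set C : ℝ := (m + 1) * (2 * (p * (R + 2)) + 1) * (4 * (m + 1) + 2) *
    (2 * (R * (m + 1)) + 1) ^ m with hC
  have hlim : Tendsto (fun q : ℕ => (q : ℝ) ^ s) atTop atTop :=
    (tendsto_rpow_atTop hs).comp tendsto_natCast_atTop_atTop
  filter_upwards [hlim.eventually_ge_atTop C, eventually_ge_atTop 1] with q hqC hq
  have hq1 : (1 : ℝ) ≤ q := by exact_mod_cast hq
  have hq0 : (0 : ℝ) < q := by linarith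
  refine (coverNum_gridNhd_le hp hq).trans ?_
  rw [← ENNReal.ofReal_natCast]
  refine ENNReal.ofReal_le_ofReal ?_
  rw [one_div, Real.inv_rpow hq0.le, ← Real.rpow_neg hq0.le, neg_neg, Real.rpow_add hq0,
    Real.rpow_natCast]
  push_cast
  calc ((m : ℝ) + 1) * (2 * (p * (R + 2)) + 1) * (4 * (m + 1) + 2) *
        (2 * (R * ((m + 1) * q)) + 1) ^ m
      ≤ ((m : ℝ) + 1) * (2 * (p * (R + 2)) + 1) * (4 * (m + 1) + 2) *
        ((2 * (R * (m + 1)) + 1) * q) ^ m := by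
        gcongr
        nlinarith
    _ = q ^ m * C := by rw [hC, mul_pow]; ring
    _ ≤ q ^ m * q ^ s := by gcongr

end Staircase

/-! ### Lower packing dimension of the set where the lower scaled oscillation is nonzero -/

section UpperBound

variable {m : ℕ} {Ω : Set (EuclideanSpace ℝ (Fin (m + 1)))}

/-- Points of the closed ball `B(c, ρ)` at which the oscillation of `f` at scale `r` exceeds
`r / (j + 1)`. -/
def largeOscillation (f : Ω → ℝ) (c : Ω) (ρ : ℝ) (j : ℕ) (r : ℝ) :
    Set (EuclideanSpace ℝ (Fin (m + 1))) :=
  {x | ∃ hx : x ∈ Ω, (⟨x, hx⟩ : Ω) ∈ Metric.closedBall c ρ ∧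
    ENNReal.ofReal (r / (j + 1)) < Metric.ediam (f '' Metric.closedBall ⟨x, hx⟩ r)}

theorem exists_extension_uniform (f : C(Ω, ℝ)) {K : Set Ω} (hK : IsCompact K) {ε : ℝ}
    (hε : 0 < ε) :
    ∃ F : C(EuclideanSpace ℝ (Fin (m + 1)), ℝ), ∃ s > 0, ∀ x ∈ K, ∀ y,
      dist y (x : EuclideanSpace ℝ (Fin (m + 1))) < s → |f x - F y| < ε := by
  have : CompactSpace K := isCompact_iff_compactSpace.1 hK
  have he : IsClosedEmbedding fun x : K => ((x : Ω) : EuclideanSpace ℝ (Fin (m + 1))) :=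
    Continuous.isClosedEmbedding (by fun_prop)
      (Subtype.val_injective.comp Subtype.val_injective)
  obtain ⟨F, hF⟩ := ContinuousMap.exists_extension he (f.restrict K)
  have hFx : ∀ x ∈ K, F x = f x := fun x hx => DFunLike.congr_fun hF ⟨x, hx⟩
  have hK' : IsCompact (Subtype.val '' K) := hK.image continuous_subtype_val
  obtain ⟨s, hs, h⟩ := Metric.mem_uniformity_dist.1
    (hK'.uniformContinuousAt_of_continuousAt F (fun x _ => F.continuous.continuousAt)
      (Metric.dist_mem_uniformity hε))
  refine ⟨F, s, hs, fun x hx y hy => ?_⟩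
  rw [dist_comm] at hy
  have := h hy (mem_image_of_mem _ hx)
  rwa [← hFx x hx]

theorem eventually_residual_coverNum_largeOscillation_le {c : Ω} {ρ : ℝ} (hρ : 0 < ρ)
    (hc : Metric.closedBall (c : EuclideanSpace ℝ (Fin (m + 1))) (2 * ρ) ⊆ Ω) (n : ℕ) :
    ∀ᶠ f : C(Ω, ℝ) in residual C(Ω, ℝ), ∃ r : ℝ, 0 < r ∧ r < 1 / ((n : ℝ) + 1) ∧
      coverNum r (largeOscillation f c ρ n r) ≤
        ENNReal.ofReal (r ^ (-(m + 1 / ((n : ℝ) + 1)))) := by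
  have hn : (0 : ℝ) < 1 / ((n : ℝ) + 1) := by positivity
  refine mem_residual_of_approx fun f K hK ε hε => ?_
  obtain ⟨F, s, hs, hF⟩ := exists_extension_uniform f hK hε
  obtain ⟨p, hp⟩ := exists_nat_gt (((m + 1 : ℕ) : ℝ) / s)
  have hp' : (0 : ℝ) < p := lt_of_le_of_lt (by positivity) hp
  have hp0 : 0 < p := by exact_mod_cast hp'
  obtain ⟨R, hR⟩ := exists_nat_ge (‖(c : EuclideanSpace ℝ (Fin (m + 1)))‖ + ρ)
  obtain ⟨q, hq, hpq, hqn, hqρ⟩ := ((exists_coverNum_gridNhd_le m p R hp0 hn).and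
    ((eventually_ge_atTop p).and
      ((tendsto_one_div_atTop_nhds_zero_nat.eventually_lt_const hn).and
      (tendsto_one_div_atTop_nhds_zero_nat.eventually_le_const hρ)))).exists
  have hq0 : 0 < q := hp0.trans_le hpq
  have hq' : (0 : ℝ) < q := by exact_mod_cast hq0
  have hη0 : (0 : ℝ) < p / q := by positivity
  have hη1 : (p : ℝ) / q ≤ 1 := (div_le_one hq').2 (by exact_mod_cast hpq)
  refine ⟨⟨fun x => F (stairMap p (p / q) x),
    F.continuous.comp ((continuous_stairMap hη0 hη1).comp continuous_subtype_val)⟩,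
    fun x hx => hF x hx _ ((dist_stairMap_le hp0 hη0 _).trans_lt ?_),
    Metric.closedBall c (2 * ρ), isCompact_closedBall_of_subset hc,
    1 / q / (n + 1) / 2, by positivity,
    fun u hu => ⟨1 / q, by positivity, hqn, (coverNum_mono ?_).trans hq⟩⟩
  · rwa [div_lt_comm₀ hp' hs]
  rintro x ⟨hx, hxc, hosc⟩
  have hxc' : dist x c ≤ ρ := hxc
  refine ⟨?_, ?_⟩
  · rw [mem_closedBall_zero_iff]
    refine le_trans ?_ hR
    have := norm_le_norm_add_norm_sub' x (c : EuclideanSpace ℝ (Fin (m + 1)))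
    rw [← dist_eq_norm] at this
    linarith
  · by_contra hgrid
    refine hosc.not_ge (Metric.ediam_le ?_)
    have hu' : ∀ y ∈ Metric.closedBall (⟨x, hx⟩ : Ω) (1 / q),
        |F (stairMap p (p / q) x) - u y| < 1 / q / (n + 1) / 2 := fun y hy => by
      have hyx : dist (y : EuclideanSpace ℝ (Fin (m + 1))) x ≤ 1 / q := hy
      rw [← stairMap_eq_of_notMem_gridNhd hp0 hq0 hgrid hyx]
      refine hu y ?_
      have := dist_triangle (y : EuclideanSpace ℝ (Fin (m + 1))) x c
      change dist (y : EuclideanSpace ℝ (Fin (m + 1))) c ≤ 2 * ρ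
      linarith
    rintro _ ⟨y, hy, rfl⟩ _ ⟨z, hz, rfl⟩
    rw [edist_dist, Real.dist_eq]
    refine ENNReal.ofReal_le_ofReal (abs_le.2 ?_)
    have h1 := abs_lt.1 (hu' y hy)
    have h2 := abs_lt.1 (hu' z hz)
    constructor <;> linarith

/-- Points of the closed ball `B(c, ρ)` at which the oscillation of `f` exceeds
`r / (j + 1)` at every scale `r < 1 / (j + 1)`. -/
def persistentOscillation (f : Ω → ℝ) (c : Ω) (ρ : ℝ) (j : ℕ) :
    Set (EuclideanSpace ℝ (Fin (m + 1))) :=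
  {x | ∀ r : ℝ, 0 < r → r < 1 / ((j : ℝ) + 1) → x ∈ largeOscillation f c ρ j r}

theorem lbdim_persistentOscillation_le {f : Ω → ℝ} {c : Ω} {ρ : ℝ}
    (h : ∀ n : ℕ, ∃ r : ℝ, 0 < r ∧ r < 1 / ((n : ℝ) + 1) ∧
      coverNum r (largeOscillation f c ρ n r) ≤
        ENNReal.ofReal (r ^ (-(m + 1 / ((n : ℝ) + 1))))) (j : ℕ) :
    lbdim (persistentOscillation f c ρ j) ≤ (m : EReal) := by
  refine le_of_forall_gt_imp_ge_of_dense fun b hb => ?_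
  obtain ⟨t, ht, htb⟩ := EReal.lt_iff_exists_real_btwn.1 hb
  have htm : (m : ℝ) < t := by exact_mod_cast ht
  refine le_trans (lbdim_le_of_frequently ?_) htb.le
  rw [(nhdsGT_basis (0 : ℝ)).frequently_iff]
  intro δ hδ
  obtain ⟨n₁, hn₁⟩ := exists_nat_one_div_lt hδ
  obtain ⟨n₂, hn₂⟩ := exists_nat_one_div_lt (sub_pos.2 htm)
  set n := max j (max n₁ n₂) with hn
  have hjn : j ≤ n := le_max_left _ _
  have h1n : n₁ ≤ n := (le_max_left _ _).trans (le_max_right _ _)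
  have h2n : n₂ ≤ n := (le_max_right _ _).trans (le_max_right _ _)
  obtain ⟨r, hr0, hr, hcov⟩ := h n
  have hr1 : r ≤ 1 := hr.le.trans (Nat.one_div_le_one_div (Nat.zero_le n) |>.trans (by simp))
  refine ⟨r, ⟨hr0, hr.trans_le ((Nat.one_div_le_one_div h1n).trans hn₁.le)⟩,
    (coverNum_mono fun x hx => ?_).trans (hcov.trans (ENNReal.ofReal_le_ofReal ?_))⟩
  · obtain ⟨hxΩ, hxc, hosc⟩ := hx r hr0 (hr.trans_le (Nat.one_div_le_one_div hjn))
    refine ⟨hxΩ, hxc, lt_of_le_of_lt (ENNReal.ofReal_le_ofReal ?_) hosc⟩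
    gcongr
  · refine Real.rpow_le_rpow_of_exponent_ge hr0 hr1 ?_
    have := (Nat.one_div_le_one_div (α := ℝ) h2n).trans_lt hn₂
    linarith

theorem exists_mem_persistentOscillation {f : Ω → ℝ} {c x : Ω} {ρ : ℝ}
    (hx : x ∈ Metric.closedBall c ρ) (h : lipGauge (fun r => r) f x ≠ 0) :
    ∃ j, (x : EuclideanSpace ℝ (Fin (m + 1))) ∈ persistentOscillation f c ρ j := by
  obtain ⟨a, ha0, ha⟩ := exists_between (pos_iff_ne_zero.2 h)
  have hev := eventually_lt_of_lt_liminf ha (by isBoundedDefault)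
  obtain ⟨b, hb, hab⟩ := (nhdsGT_basis (0 : ℝ)).eventually_iff.1 hev
  obtain ⟨n₁, hn₁⟩ := exists_nat_one_div_lt hb
  have ha' : a ≠ ⊤ := ha.ne_top
  obtain ⟨n₂, hn₂⟩ := exists_nat_one_div_lt (ENNReal.toReal_pos ha0.ne' ha')
  refine ⟨max n₁ n₂, fun r hr0 hr => ⟨x.2, hx, ?_⟩⟩
  have hlt := hab ⟨hr0, hr.trans_le ((Nat.one_div_le_one_div (le_max_left _ _)).trans hn₁.le)⟩
  have hlt' := (ENNReal.lt_div_iff_mul_lt (by simp [hr0]) (by simp)).1 hlt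
  refine lt_of_le_of_lt ?_ hlt'
  rw [div_eq_mul_one_div, mul_comm, ENNReal.ofReal_mul (by positivity)]
  gcongr
  rw [← ENNReal.ofReal_toReal ha']
  exact ENNReal.ofReal_le_ofReal ((Nat.one_div_le_one_div (le_max_right _ _)).trans hn₂.le)

theorem lpdim_le_of_subset_iUnion {X : Type*} [PseudoMetricSpace X] {ι : Type*} [Nonempty ι]
    [Countable ι] {E : Set X} {G : ι → Set X} {a : EReal} (hE : E ⊆ ⋃ i, G i)
    (hG : ∀ i, lbdim (G i) ≤ a) : lpdim E ≤ a := by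
  obtain ⟨e, he⟩ := exists_surjective_nat ι
  refine (iInf₂_le (fun n => G (e n)) ?_).trans (iSup_le fun n => hG (e n))
  rwa [he.iUnion_comp G]

theorem exists_countable_closedBall_cover (hopen : IsOpen Ω) :
    ∃ (S : Set Ω) (ρ : Ω → ℝ), S.Countable ∧ (∀ x, 0 < ρ x) ∧
      (∀ x : Ω, Metric.closedBall (x : EuclideanSpace ℝ (Fin (m + 1))) (2 * ρ x) ⊆ Ω) ∧
      ∀ x : Ω, ∃ c ∈ S, x ∈ Metric.closedBall c (ρ c) := by
  have h : ∀ x : Ω, ∃ ρ > 0,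
      Metric.closedBall (x : EuclideanSpace ℝ (Fin (m + 1))) (2 * ρ) ⊆ Ω := fun x => by
    obtain ⟨ρ, hρ, h⟩ := Metric.nhds_basis_closedBall.mem_iff.1 (hopen.mem_nhds x.2)
    exact ⟨ρ / 2, half_pos hρ, by rwa [mul_div_cancel₀ _ two_ne_zero]⟩
  choose ρ hρ hsub using h
  obtain ⟨S, hS, hcov⟩ := TopologicalSpace.countable_cover_nhds
    fun x : Ω => Metric.closedBall_mem_nhds x (hρ x)
  refine ⟨S, ρ, hS, hρ, hsub, fun x => ?_⟩
  exact mem_iUnion₂.1 (hcov.symm ▸ mem_univ x) |>.imp fun c ⟨hc, hx⟩ => ⟨hc, hx⟩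

theorem eventually_residual_lpdim_lipGauge_ne_zero_le (hopen : IsOpen Ω)
    (hne : Ω.Nonempty) :
    ∀ᶠ f : C(Ω, ℝ) in residual C(Ω, ℝ),
      lpdim {x | ∃ hx : x ∈ Ω, lipGauge (fun r => r) f ⟨x, hx⟩ ≠ 0} ≤ (m : EReal) := by
  obtain ⟨S, ρ, hS, hρ, hsub, hcov⟩ := exists_countable_closedBall_cover hopen
  filter_upwards [(eventually_countable_ball hS).2 fun c _ =>
    eventually_countable_forall.2 fun n =>
      eventually_residual_coverNum_largeOscillation_le (hρ c) (hsub c) n] with f hf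
  have := hS.to_subtype
  obtain ⟨x₀, hx₀⟩ := hne
  obtain ⟨c₀, hc₀, -⟩ := hcov ⟨x₀, hx₀⟩
  have : Nonempty S := ⟨⟨c₀, hc₀⟩⟩
  refine lpdim_le_of_subset_iUnion
    (G := fun i : S × ℕ => persistentOscillation f i.1 (ρ i.1) i.2) ?_
    fun i => lbdim_persistentOscillation_le (hf i.1 i.1.2) i.2
  rintro x ⟨hx, hne⟩
  obtain ⟨c, hc, hxc⟩ := hcov ⟨x, hx⟩
  obtain ⟨j, hj⟩ := exists_mem_persistentOscillation hxc hne
  exact mem_iUnion.2 ⟨(⟨c, hc⟩, j), hj⟩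

theorem eventually_residual_LipGauge_ne_zero (hopen : IsOpen Ω) :
    ∀ᶠ f : C(Ω, ℝ) in residual C(Ω, ℝ), ∀ x, LipGauge (fun r => r) f x ≠ 0 := by
  obtain ⟨S, ρ, hS, hρ, hsub, hcov⟩ := exists_countable_closedBall_cover hopen
  filter_upwards [(eventually_countable_ball hS).2 fun c _ =>
    eventually_countable_forall.2 fun n : ℕ =>
      eventually_residual_large_oscillation m.succ_pos (hρ c) (hsub c)
        (b := 1 / ((n : ℝ) + 1)) (by positivity)] with f hf x
  obtain ⟨c, hc, hxc⟩ := hcov x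
  exact LipGauge_ne_zero fun n => hf c hc n x hxc

theorem volume_eq_zero_of_dimH_le {E : Set (EuclideanSpace ℝ (Fin (m + 1)))} (h : dimH E ≤ m) :
    volume E = 0 := by
  have : (μH[((m + 1 : ℕ) : ℝ≥0)] : Measure (EuclideanSpace ℝ (Fin (m + 1)))).IsAddHaarMeasure := by
    have := MeasureTheory.isAddHaarMeasure_hausdorffMeasure
      (E := EuclideanSpace ℝ (Fin (m + 1)))
    simpa using this
  refine measure_zero_of_dimH_lt (d := ((m + 1 : ℕ) : ℝ≥0))
    (Measure.absolutelyContinuous_isAddHaarMeasure _ _) (h.trans_lt ?_)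
  exact_mod_cast Nat.lt_succ_self m

theorem exists_segment_subset (hopen : IsOpen Ω) (hne : Ω.Nonempty) :
    ∃ (a b : ℝ) (y : Fin m → ℝ), a < b ∧ ∀ t ∈ Icc a b, consPoint t y ∈ Ω := by
  obtain ⟨x, hx⟩ := hne
  obtain ⟨R, hR, h⟩ := Metric.nhds_basis_closedBall.mem_iff.1 (hopen.mem_nhds hx)
  have hx' : consPoint (x 0) (tailCoord x) = x := by
    ext i
    refine Fin.cases ?_ (fun j => ?_) i <;> simp [consPoint, tailCoord]
  refine ⟨x 0, x 0 + R, tailCoord x, by linarith, fun t ht => h ?_⟩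
  have hdist := dist_consPoint t (x 0) (tailCoord x)
  rw [hx'] at hdist
  rw [Metric.mem_closedBall, hdist, abs_of_nonneg]
  · linarith [ht.2]
  · linarith [ht.1]

theorem eventually_residual_dim_eq (hopen : IsOpen Ω) (hne : Ω.Nonempty) :
    ∀ᶠ f : C(Ω, ℝ) in residual C(Ω, ℝ),
      dimH {x | ∃ hx : x ∈ Ω,
        lipGauge (fun r => r) f ⟨x, hx⟩ = LipGauge (fun r => r) f ⟨x, hx⟩} = (m : ℝ≥0∞) ∧
      lpdim {x | ∃ hx : x ∈ Ω,
        lipGauge (fun r => r) f ⟨x, hx⟩ = LipGauge (fun r => r) f ⟨x, hx⟩} = (m : EReal) := by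
  obtain ⟨a, b, y, hab, hseg⟩ := exists_segment_subset hopen hne
  have hne' : (⟨consPoint a y, hseg a ⟨le_rfl, hab.le⟩⟩ : Ω) ≠
      ⟨consPoint b y, hseg b ⟨hab.le, le_rfl⟩⟩ := by
    rw [← dist_pos, Subtype.dist_eq, dist_consPoint]
    exact abs_pos.2 (sub_ne_zero.2 hab.ne)
  filter_upwards [eventually_residual_lpdim_lipGauge_ne_zero_le hopen hne,
    eventually_residual_LipGauge_ne_zero hopen, eventually_residual_apply_ne hne']
    with f hlp hLip hf
  set E := {x | ∃ hx : x ∈ Ω,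
    lipGauge (fun r => r) f ⟨x, hx⟩ = LipGauge (fun r => r) f ⟨x, hx⟩} with hE
  set N := {x | ∃ hx : x ∈ Ω, lipGauge (fun r => r) f ⟨x, hx⟩ ≠ 0} with hN
  set I := {x | ∃ hx : x ∈ Ω, lipGauge (fun r => r) f ⟨x, hx⟩ = ⊤} with hI
  have hIE : I ⊆ E := by
    rintro x ⟨hx, h⟩
    exact ⟨hx, h.trans (top_le_iff.1 (h ▸ liminf_le_limsup)).symm⟩
  have hEN : E ⊆ N := by
    rintro x ⟨hx, h⟩
    exact ⟨hx, h ▸ hLip ⟨x, hx⟩⟩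
  have hcast : (((m : ℝ≥0∞) : EReal)) = (m : EReal) := by norm_cast
  have hdimN : dimH N ≤ m := by
    rcases N.eq_empty_or_nonempty with h | h
    · simp [h]
    · have := (dimH_le_lpdim h).trans hlp
      rw [← hcast] at this
      exact EReal.coe_ennreal_le_coe_ennreal_iff.1 this
  have hIvol := volume_tailCoord_image_ne_zero hopen f (volume_eq_zero_of_dimH_le hdimN) hab.le
    hseg hf
  have hI0 : I.Nonempty := by
    by_contra h
    rw [not_nonempty_iff_eq_empty] at h
    exact hIvol (by simp [← hI, h])
  have hEdim : dimH E = m := le_antisymm ((dimH_mono hEN).trans hdimN)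
    (le_trans (by simpa using le_dimH_of_volume_tailCoord_image_ne_zero hIvol) (dimH_mono hIE))
  refine ⟨hEdim, le_antisymm ((iInf₂_mono' fun G hG => ⟨G, hEN.trans hG, le_rfl⟩).trans hlp) ?_⟩
  rw [← hcast, ← hEdim]
  exact dimH_le_lpdim (hI0.mono hIE)

end UpperBound

theorem stmt5
    (d : ℕ) (hd : 0 < d) (Ω : Set (EuclideanSpace ℝ (Fin d)))
    (hopen : IsOpen Ω) (hconn : IsConnected Ω) :
    ∀ᶠ f : C(↥Ω, ℝ) in residual C(↥Ω, ℝ),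
      dimH {x : EuclideanSpace ℝ (Fin d) | ∃ hx : x ∈ Ω,
              lipGauge (fun r => r) (⇑f) ⟨x, hx⟩ = LipGauge (fun r => r) (⇑f) ⟨x, hx⟩}
          = ((d - 1 : ℕ) : ℝ≥0∞) ∧
      lpdim {x : EuclideanSpace ℝ (Fin d) | ∃ hx : x ∈ Ω,
              lipGauge (fun r => r) (⇑f) ⟨x, hx⟩ = LipGauge (fun r => r) (⇑f) ⟨x, hx⟩}
          = ((d - 1 : ℕ) : EReal) := by
  obtain ⟨m, rfl⟩ : ∃ m, d = m + 1 := ⟨d - 1, by omega⟩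
  exact eventually_residual_dim_eq hopen hconn.nonempty
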